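/- arXiv:1910.03719 — 4 statements merged into one kernel-verified Lean document; each statement's English description precedes it below -/
import Mathlib

section
/- Let f be L-Lipschitz on X, let x : ℕ → ℝⁿ be a trajectory of the system (x_{k+1} = f(x_k) with x_k ∈ X for all k), and suppose the trajectory converges to a point x_eq ∈ X. Then for every ε > 0 there exists N̄ ∈ ℕ such that for every N ≥ N̄, every point x̄ ∈ X with ‖x̄ − x_eq‖ ≤ ε, and every y ∈ F_N(x̄), one has ‖y − f(x̄)‖ ≤ 4·L·ε. -/
/-- If an L-Lipschitz-on-X trajectory converges to `xeq ∈ X`, then for every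
`ε > 0` there is `Nbar` such that for all `N ≥ Nbar`, all `xb ∈ X` with `‖xb - xeq‖ ≤ ε`, and all
`y ∈ F_N(xb)`, one has `‖y - f xb‖ ≤ 4 L ε`. -/
theorem stmt_0 (n : ℕ) (X : Set (EuclideanSpace ℝ (Fin n)))
    (f : EuclideanSpace ℝ (Fin n) → EuclideanSpace ℝ (Fin n)) (L : ℝ) (hL : 0 < L)
    (hf : ∀ x ∈ X, ∀ y ∈ X, ‖f x - f y‖ ≤ L * ‖x - y‖)
    (x : ℕ → EuclideanSpace ℝ (Fin n))
    (hxX : ∀ k, x k ∈ X)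
    (hstep : ∀ k, x (k + 1) = f (x k))
    (xeq : EuclideanSpace ℝ (Fin n)) (hxeq : xeq ∈ X)
    (hconv : Filter.Tendsto x Filter.atTop (nhds xeq)) :
    ∀ ε > (0 : ℝ), ∃ Nbar : ℕ, ∀ N ≥ Nbar, ∀ xb ∈ X, ‖xb - xeq‖ ≤ ε →
      ∀ y ∈ ⋂ k ∈ Finset.range N,
          {y' : EuclideanSpace ℝ (Fin n) | ‖y' - f (x k)‖ ≤ L * ‖xb - x k‖},
        ‖y - f xb‖ ≤ 4 * L * ε := by
  intro ε hε
  obtain ⟨K, hK⟩ := Metric.tendsto_atTop.1 hconv ε hε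
  refine ⟨K + 1, fun N hN xb hxb hd y hy => ?_⟩
  have hyK : ‖y - f (x K)‖ ≤ L * ‖xb - x K‖ :=
    Set.mem_iInter₂.1 hy K (Finset.mem_range.2 (by omega))
  have hKe : dist (x K) xeq < ε := hK K le_rfl
  have h1 := hf (x K) (hxX K) xb hxb
  rw [norm_sub_rev (x K) xb] at h1
  have h2 : ‖xb - x K‖ ≤ 2 * ε := by
    have h3 := dist_triangle_right xb (x K) xeq
    rw [← dist_eq_norm] at hd ⊢
    linarith
  have h4 := norm_sub_le_norm_sub_add_norm_sub y (f (x K)) (f xb)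
  have h5 := mul_le_mul_of_nonneg_left h2 hL.le
  linarith
end

section
/- Let f : X → X be L-Lipschitz on X, let x_0, …, x_{N−1} ∈ X, let x_eq ∈ ℝⁿ, let P_1, …, P_{n_I} be symmetric positive definite n×n real matrices, let ρ_{jm} > 0 for j, m ∈ {1, …, n_I}, and let τ_0, …, τ_{N−1} ≥ 0. Define X_I = {x ∈ ℝⁿ : (x − x_eq)ᵀ P_j (x − x_eq) ≤ 1 for all j = 1, …, n_I} and assume X_I ⊆ X. Suppose that for every m ∈ {1, …, n_I} and all x, y ∈ ℝⁿ, Σ_{j=1}^{n_I} [ −ρ_{jm}·((x − x_eq)ᵀ P_j (x − x_eq) − 1) + ((y − x_eq)ᵀ P_m (y − x_eq) − 1) ] − Σ_{k=0}^{N−1} τ_k·( ‖y − f(x_k)‖² − L²‖x − x_k‖² ) ≤ 0. Then X_I is positive invariant for f, i.e., for every x ∈ X_I, f(x) ∈ X_I. -/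
open scoped Matrix

/-- Scalarized BMI sufficiency condition for positive invariance of the set
`X_I = {x : (x - x_eq)ᵀ P_j (x - x_eq) ≤ 1, j = 1..n_I}` for the unknown dynamics `f`. -/
theorem stmt_1 (n nI N : ℕ) (hnI : 1 ≤ nI) (hN : 1 ≤ N)
    (X : Set (EuclideanSpace ℝ (Fin n)))
    (f : EuclideanSpace ℝ (Fin n) → EuclideanSpace ℝ (Fin n))
    (hfX : ∀ x ∈ X, f x ∈ X)
    (L : ℝ) (hL : 0 < L)
    (hf : ∀ x ∈ X, ∀ y ∈ X, ‖f x - f y‖ ≤ L * ‖x - y‖)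
    (x : ℕ → EuclideanSpace ℝ (Fin n)) (hx : ∀ k < N, x k ∈ X)
    (xeq : EuclideanSpace ℝ (Fin n))
    (P : Fin nI → Matrix (Fin n) (Fin n) ℝ)
    (hPsymm : ∀ j, (P j).IsSymm) (hPpos : ∀ j, (P j).PosDef)
    (ρ : Fin nI → Fin nI → ℝ) (hρ : ∀ j m, 0 < ρ j m)
    (τ : ℕ → ℝ) (hτ : ∀ k < N, 0 ≤ τ k)
    (XI : Set (EuclideanSpace ℝ (Fin n)))
    (hXI : XI = {x' : EuclideanSpace ℝ (Fin n) |
      ∀ j : Fin nI,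
        (fun i => (x' - xeq) i) ⬝ᵥ (P j) *ᵥ (fun i => (x' - xeq) i) ≤ 1})
    (hXIX : XI ⊆ X)
    (hBMI : ∀ m : Fin nI, ∀ x' y : EuclideanSpace ℝ (Fin n),
      (∑ j : Fin nI,
          (-(ρ j m) *
              ((fun i => (x' - xeq) i) ⬝ᵥ (P j) *ᵥ (fun i => (x' - xeq) i) - 1) +
            ((fun i => (y - xeq) i) ⬝ᵥ (P m) *ᵥ (fun i => (y - xeq) i) - 1))) -
        ∑ k ∈ Finset.range N, τ k * (‖y - f (x k)‖ ^ 2 - L ^ 2 * ‖x' - x k‖ ^ 2) ≤ 0) :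
    ∀ x' ∈ XI, f x' ∈ XI := by
  intro z hz
  have hzX := hXIX hz
  have hz' := hz
  rw [hXI] at hz' ⊢
  simp only [Set.mem_setOf_eq] at hz' ⊢
  intro m
  have h := hBMI m z (f z)
  rw [Finset.sum_add_distrib] at h
  have h1 : 0 ≤ ∑ j : Fin nI, (-(ρ j m) *
      ((fun i => (z - xeq) i) ⬝ᵥ (P j) *ᵥ (fun i => (z - xeq) i) - 1)) := by
    apply Finset.sum_nonneg
    intro j _
    exact mul_nonneg_of_nonpos_of_nonpos (by linarith [hρ j m]) (by linarith [hz' j])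
  have h2 : ∑ k ∈ Finset.range N,
      τ k * (‖f z - f (x k)‖ ^ 2 - L ^ 2 * ‖z - x k‖ ^ 2) ≤ 0 := by
    apply Finset.sum_nonpos
    intro k hk
    have hk' := Finset.mem_range.mp hk
    apply mul_nonpos_of_nonneg_of_nonpos (hτ k hk')
    have h3 := pow_le_pow_left₀ (norm_nonneg _) (hf z hzX (x k) (hx k hk')) 2
    rw [mul_pow] at h3
    linarith
  rw [Finset.sum_const, Finset.card_univ, Fintype.card_fin, nsmul_eq_mul] at h
  have h4 : (0 : ℝ) < nI := by exact_mod_cast hnI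
  by_contra hc
  push Not at hc
  have h5 := mul_pos h4 (sub_pos.mpr hc)
  linarith
end

section
/- Let f be L-Lipschitz on X, let x_k ∈ X with x_{k+1} := f(x_k), and let W ⊆ ℝⁿ be a set that is symmetric about the origin (w ∈ W implies −w ∈ W). Let w_k, w_{k+1} ∈ W and define the noisy measurements z_k = x_k + w_k and z_{k+1} = x_{k+1} + w_{k+1}. Then the graph of f is contained in the Minkowski sum of the noisy envelope with W × W: G(f) ⊆ {(x', y') ∈ ℝⁿ × ℝⁿ : ‖y' − z_{k+1}‖ ≤ L‖x' − z_k‖} ⊕ (W × W), where A ⊕ B = {a + b : a ∈ A, b ∈ B}. -/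
open scoped Pointwise

/-- With symmetric bounded measurement noise, the graph of `f` is contained in
the Minkowski sum of the noisy envelope with `W × W`. -/
theorem stmt_13 (n : ℕ) (X : Set (EuclideanSpace ℝ (Fin n)))
    (f : EuclideanSpace ℝ (Fin n) → EuclideanSpace ℝ (Fin n)) (L : ℝ) (hL : 0 < L)
    (hf : ∀ x ∈ X, ∀ y ∈ X, ‖f x - f y‖ ≤ L * ‖x - y‖)
    (xk : EuclideanSpace ℝ (Fin n)) (hxk : xk ∈ X)
    (W : Set (EuclideanSpace ℝ (Fin n))) (hW : ∀ w ∈ W, -w ∈ W)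
    (wk wk1 : EuclideanSpace ℝ (Fin n)) (hwk : wk ∈ W) (hwk1 : wk1 ∈ W)
    (zk zk1 : EuclideanSpace ℝ (Fin n))
    (hzk : zk = xk + wk) (hzk1 : zk1 = f xk + wk1) :
    {p : EuclideanSpace ℝ (Fin n) × EuclideanSpace ℝ (Fin n) | ∃ x ∈ X, p = (x, f x)} ⊆
      {p : EuclideanSpace ℝ (Fin n) × EuclideanSpace ℝ (Fin n) |
        ‖p.2 - zk1‖ ≤ L * ‖p.1 - zk‖} + (W ×ˢ W) := by
  rintro p ⟨x, hx, rfl⟩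
  refine Set.mem_add.2 ⟨(x + wk, f x + wk1), ?_, (-wk, -wk1), ⟨hW _ hwk, hW _ hwk1⟩, ?_⟩
  · simp only [Set.mem_setOf_eq, hzk, hzk1, add_sub_add_right_eq_sub]
    exact hf x hx xk hxk
  · simp
end

section
/- Let f be L-Lipschitz on X, let x_0, …, x_{N−1} ∈ X, let x̄ ∈ ℝⁿ, let c ∈ ℝⁿ, let R be a symmetric positive definite n×n real matrix, and let τ_0, …, τ_{N−1} ≥ 0. Suppose that for all y ∈ ℝⁿ, (y − c)ᵀ R⁻¹ (y − c) − 1 − Σ_{k=0}^{N−1} τ_k·( ‖y − f(x_k)‖² − L²‖x̄ − x_k‖² ) ≤ 0. Then F_N(x̄) is contained in the ellipsoid ell(c, R) = {y ∈ ℝⁿ : (y − c)ᵀ R⁻¹ (y − c) ≤ 1}. -/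
open scoped Matrix

/-- If the scalarized S-procedure certificate holds, then the set-valued
estimate `F_N(x̄)` is contained in the ellipsoid `ell(c, R)`. -/
theorem stmt_14 (n N : ℕ) (hN : 1 ≤ N) (X : Set (EuclideanSpace ℝ (Fin n)))
    (f : EuclideanSpace ℝ (Fin n) → EuclideanSpace ℝ (Fin n)) (L : ℝ) (hL : 0 < L)
    (hf : ∀ x ∈ X, ∀ y ∈ X, ‖f x - f y‖ ≤ L * ‖x - y‖)
    (x : ℕ → EuclideanSpace ℝ (Fin n)) (hx : ∀ k < N, x k ∈ X)
    (xb : EuclideanSpace ℝ (Fin n)) (c : EuclideanSpace ℝ (Fin n))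
    (R : Matrix (Fin n) (Fin n) ℝ) (hRsymm : R.IsSymm) (hRpos : R.PosDef)
    (τ : ℕ → ℝ) (hτ : ∀ k < N, 0 ≤ τ k)
    (hSproc : ∀ y : EuclideanSpace ℝ (Fin n),
      (fun i => (y - c) i) ⬝ᵥ R⁻¹ *ᵥ (fun i => (y - c) i) - 1 -
          ∑ k ∈ Finset.range N, τ k * (‖y - f (x k)‖ ^ 2 - L ^ 2 * ‖xb - x k‖ ^ 2) ≤ 0) :
    (⋂ k ∈ Finset.range N,
        {y : EuclideanSpace ℝ (Fin n) | ‖y - f (x k)‖ ≤ L * ‖xb - x k‖}) ⊆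
      {y : EuclideanSpace ℝ (Fin n) |
        (fun i => (y - c) i) ⬝ᵥ R⁻¹ *ᵥ (fun i => (y - c) i) ≤ 1} := by
  intro y hy
  simp only [Set.mem_iInter, Set.mem_setOf_eq, Finset.mem_range] at hy ⊢
  have h := hSproc y
  have hs : ∑ k ∈ Finset.range N,
      τ k * (‖y - f (x k)‖ ^ 2 - L ^ 2 * ‖xb - x k‖ ^ 2) ≤ 0 := by
    apply Finset.sum_nonpos
    intro k hk
    have hk' := Finset.mem_range.mp hk
    apply mul_nonpos_of_nonneg_of_nonpos (hτ k hk')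
    have h2 := pow_le_pow_left₀ (norm_nonneg _) (hy k hk') 2
    rw [mul_pow] at h2
    linarith
  linarith
end
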